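/- arXiv:1112.2554 — 2 statements merged into one kernel-verified Lean document; each statement's English description precedes it below -/
import Mathlib

section
/- For any pair of integers (l, n) with l > n ≥ 1, the sum of all multiple zeta values of weight l and depth n equals ζ(l); that is, Σ_{l₁≥2, l₂,…,l_n≥1, l₁+⋯+l_n=l} ζ(l₁,…,l_n) = ζ(l), where ζ(l) is the value of the Riemann zeta function at l. -/
open scoped BigOperators

/-- The multiple zeta value `ζ(l₁, …, lₙ)`, as a sum over strictly decreasing
tuples of positive integers. -/
noncomputable def mzv {n : ℕ} (l : Fin n → ℕ) : ℝ :=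
  ∑' m : {m : Fin n → ℕ // StrictAnti m ∧ ∀ i, 0 < m i},
    ∏ i, ((m.1 i : ℝ) ^ (l i))⁻¹

/-- The Riemann zeta value `ζ(k)`. -/
noncomputable def rz (k : ℕ) : ℝ := ∑' m : ℕ+, ((m : ℝ) ^ k)⁻¹

open scoped ENNReal
open Filter Topology

/-- The product `∏_{j=1}^{m} (1 + y / (j - x))`. -/
noncomputable def shiftedProd (x y : ℝ) (m : ℕ) : ℝ :=
  ∏ j ∈ Finset.range m, (1 + y / (j + 1 - x))

/-- The terms of the hypergeometric series generating the sums of multiple zeta values. -/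
noncomputable def hyperTerm (x y : ℝ) (m : ℕ) : ℝ :=
  shiftedProd x y m / ((m + 1) * (m + 1 - x))

lemma shiftedProd_succ (x y : ℝ) (m : ℕ) :
    shiftedProd x y (m + 1) = shiftedProd x y m * (1 + y / (m + 1 - x)) :=
  Finset.prod_range_succ _ _

lemma shiftedProd_nonneg {x y : ℝ} (hx : x ≤ 1 / 4) (hxy : x - 1 ≤ y) (m : ℕ) :
    0 ≤ shiftedProd x y m := by
  refine Finset.prod_nonneg fun j _ => ?_
  have hj : (0 : ℝ) ≤ j := j.cast_nonneg
  have h : 0 < (j : ℝ) + 1 - x := by linarith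
  rw [one_add_div h.ne']
  exact div_nonneg (by linarith) h.le

lemma shiftedProd_le_sqrt {x y : ℝ} (hx : x ≤ 1 / 4) (hy : y ≤ 1 / 4) (hxy : x - 1 ≤ y)
    (m : ℕ) : shiftedProd x y m ≤ √(m + 1) := by
  refine Real.le_sqrt_of_sq_le ?_
  induction m with
  | zero => simp [shiftedProd]
  | succ m ih =>
    have hm : (0 : ℝ) ≤ m := m.cast_nonneg
    have h : 0 < (m : ℝ) + 1 - x := by linarith
    have h1 : 0 ≤ 1 + y / (m + 1 - x) := by
      rw [one_add_div h.ne']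
      exact div_nonneg (by linarith) h.le
    have h2 : y / (m + 1 - x) ≤ 1 / (3 * (m + 1)) := by
      rw [div_le_div_iff₀ h (by positivity)]
      nlinarith
    rw [shiftedProd_succ, mul_pow]
    calc shiftedProd x y m ^ 2 * (1 + y / (m + 1 - x)) ^ 2
        ≤ (m + 1) * (1 + 1 / (3 * (m + 1))) ^ 2 := by gcongr
      _ ≤ ((m + 1 : ℕ) : ℝ) + 1 := by
        have h3 : ((m : ℝ) + 1) * (1 + 1 / (3 * (m + 1))) ^ 2
            = (m + 1) + 2 / 3 + 1 / (9 * (m + 1)) := by field_simp; ring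
        have h4 : 1 / (9 * ((m : ℝ) + 1)) ≤ 1 / 3 := by
          apply one_div_le_one_div_of_le <;> linarith
        push_cast
        linarith

lemma hyperTerm_nonneg {x y : ℝ} (hx : x ≤ 1 / 4) (hxy : x - 1 ≤ y) (m : ℕ) :
    0 ≤ hyperTerm x y m := by
  have hm : (0 : ℝ) ≤ m := m.cast_nonneg
  exact div_nonneg (shiftedProd_nonneg hx hxy m) (mul_nonneg (by linarith) (by linarith))

lemma hyperTerm_le {x y : ℝ} (hx : x ≤ 1 / 4) (hy : y ≤ 1 / 4) (hxy : x - 1 ≤ y)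
    (m : ℕ) : hyperTerm x y m ≤ √(m + 1) / ((m + 1) * (m + 1 - x)) := by
  have hm : (0 : ℝ) ≤ m := m.cast_nonneg
  exact div_le_div_of_nonneg_right (shiftedProd_le_sqrt hx hy hxy m)
    (mul_nonneg (by linarith) (by linarith))

lemma hyperTerm_le_rpow {x y : ℝ} (hx : x ≤ 1 / 4) (hy : y ≤ 1 / 4) (hxy : x - 1 ≤ y)
    (m : ℕ) : hyperTerm x y m ≤ 4 / 3 * (1 / ((m + 1 : ℕ) : ℝ) ^ (3 / 2 : ℝ)) := by
  have hm : (0 : ℝ) ≤ m := m.cast_nonneg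
  refine (hyperTerm_le hx hy hxy m).trans ?_
  have e : ((m + 1 : ℕ) : ℝ) ^ (3 / 2 : ℝ) = (m + 1) * √(m + 1) := by
    rw [Real.sqrt_eq_rpow, show (3 / 2 : ℝ) = 1 + 1 / 2 by norm_num,
      Real.rpow_add (by positivity), Real.rpow_one]
    push_cast; rfl
  have hs : 0 < √((m : ℝ) + 1) := Real.sqrt_pos.2 (by linarith)
  have hq : √((m : ℝ) + 1) * √((m : ℝ) + 1) = m + 1 := Real.mul_self_sqrt (by linarith)
  rw [e, mul_one_div, div_le_div_iff₀ (mul_pos (by linarith) (by linarith)) (by positivity)]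
  have : √((m : ℝ) + 1) * ((m + 1) * √(m + 1)) = (m + 1) * (m + 1) := by
    rw [mul_left_comm, hq]
  rw [this]
  nlinarith

lemma summable_hyperBound :
    Summable fun m : ℕ => 4 / 3 * (1 / ((m + 1 : ℕ) : ℝ) ^ (3 / 2 : ℝ)) :=
  ((summable_nat_add_iff 1).2
    (Real.summable_one_div_nat_rpow.2 (by norm_num : (1 : ℝ) < 3 / 2))).mul_left _

lemma summable_hyperTerm {x y : ℝ} (hx : x ≤ 1 / 4) (hy : y ≤ 1 / 4) (hxy : x - 1 ≤ y) :
    Summable (hyperTerm x y) :=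
  Summable.of_nonneg_of_le (hyperTerm_nonneg hx hxy) (hyperTerm_le_rpow hx hy hxy)
    summable_hyperBound

lemma shiftedProd_sub_one {x : ℝ} (y : ℝ) (hx : x ≤ 1 / 4) (m : ℕ) :
    shiftedProd (x - 1) (y - 1) m = shiftedProd x y m * ((1 - x) / (m + 1 - x)) := by
  induction m with
  | zero =>
    have : 1 - x ≠ 0 := by linarith
    simp [shiftedProd, this]
  | succ m ih =>
    have hm : (0 : ℝ) ≤ m := m.cast_nonneg
    have h : (m : ℝ) + 1 - x ≠ 0 := by linarith
    have h' : (m : ℝ) + 1 + 1 - x ≠ 0 := by linarith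
    have h'' : (m : ℝ) + 1 - (x - 1) ≠ 0 := by linarith
    rw [shiftedProd_succ, shiftedProd_succ, ih]
    push_cast
    field_simp
    ring

lemma hyperTerm_eq {x y : ℝ} (hx : x ≤ 1 / 4) (hy : y ≤ 1 / 4) (m : ℕ) :
    hyperTerm x y m = hyperTerm (x - 1) (y - 1) m +
      (shiftedProd x y m / (m + 1 - x) - shiftedProd x y (m + 1) / ((m + 1 : ℕ) + 1 - x))
        / (1 - y) := by
  have hm : (0 : ℝ) ≤ m := m.cast_nonneg
  have h : (m : ℝ) + 1 - x ≠ 0 := by linarith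
  have h' : (m : ℝ) + 1 + 1 - x ≠ 0 := by linarith
  have h'' : (m : ℝ) + 1 - (x - 1) ≠ 0 := by linarith
  have hy' : 1 - y ≠ 0 := by linarith
  have hm' : (m : ℝ) + 1 ≠ 0 := by linarith
  unfold hyperTerm
  rw [shiftedProd_sub_one y hx, shiftedProd_succ]
  push_cast
  generalize shiftedProd x y m = P
  field_simp
  ring

lemma tendsto_shiftedProd_div {x y : ℝ} (hx : x ≤ 1 / 4) (hy : y ≤ 1 / 4) (hxy : x - 1 ≤ y) :
    Tendsto (fun m : ℕ => shiftedProd x y m / (m + 1 - x)) atTop (𝓝 0) := by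
  have h0 : Tendsto (fun m : ℕ => 4 / 3 * (√((m : ℝ) + 1))⁻¹) atTop (𝓝 0) := by
    rw [← mul_zero (4 / 3 : ℝ)]
    refine Tendsto.const_mul _ (tendsto_inv_atTop_zero.comp ?_)
    exact Real.tendsto_sqrt_atTop.comp
      (tendsto_atTop_add_const_right _ _ tendsto_natCast_atTop_atTop)
  refine squeeze_zero (fun m => ?_) (fun m => ?_) h0
  · have hm : (0 : ℝ) ≤ m := m.cast_nonneg
    exact div_nonneg (shiftedProd_nonneg hx hxy m) (by linarith)
  · have hm : (0 : ℝ) ≤ m := m.cast_nonneg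
    have hs : 0 < √((m : ℝ) + 1) := Real.sqrt_pos.2 (by linarith)
    have hq : √((m : ℝ) + 1) * √((m : ℝ) + 1) = m + 1 := Real.mul_self_sqrt (by linarith)
    rw [← div_eq_mul_inv, div_le_div_iff₀ (by linarith) hs]
    nlinarith [shiftedProd_le_sqrt hx hy hxy m]

lemma tsum_hyperTerm_eq {x y : ℝ} (hx : x ≤ 1 / 4) (hy : y ≤ 1 / 4) (hxy : x - 1 ≤ y) :
    ∑' m, hyperTerm x y m =
      1 / ((1 - x) * (1 - y)) + ∑' m, hyperTerm (x - 1) (y - 1) m := by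
  have hs' := summable_hyperTerm (x := x - 1) (y := y - 1) (by linarith) (by linarith)
    (by linarith)
  have ht : HasSum (fun m : ℕ => hyperTerm x y m - hyperTerm (x - 1) (y - 1) m)
      (1 / ((1 - x) * (1 - y))) := by
    refine ((summable_hyperTerm hx hy hxy).sub hs').hasSum_iff_tendsto_nat.2 ?_
    have h1 : ∀ N : ℕ, ∑ m ∈ Finset.range N,
        (hyperTerm x y m - hyperTerm (x - 1) (y - 1) m) =
        (1 / (1 - x) - shiftedProd x y N / (N + 1 - x)) / (1 - y) := by
      intro N
      rw [Finset.sum_congr rfl fun m _ => sub_eq_of_eq_add' (hyperTerm_eq hx hy m),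
        ← Finset.sum_div,
        Finset.sum_range_sub' (fun m : ℕ => shiftedProd x y m / (m + 1 - x))]
      simp [shiftedProd]
    simp_rw [h1]
    have := ((tendsto_shiftedProd_div hx hy hxy).const_sub (1 / (1 - x))).div_const (1 - y)
    rwa [sub_zero, div_div] at this
  rw [← ht.tsum_eq, ← ((summable_hyperTerm hx hy hxy).sub hs').tsum_add hs']
  simp

lemma tsum_hyperTerm_eq_sum_add {x y : ℝ} (hx : x ≤ 1 / 4) (hy : y ≤ 1 / 4)
    (hxy : x - 1 ≤ y) (K : ℕ) :
    ∑' m, hyperTerm x y m =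
      ∑ k ∈ Finset.range K, 1 / (((k : ℝ) + 1 - x) * (k + 1 - y))
        + ∑' m, hyperTerm (x - K) (y - K) m := by
  induction K with
  | zero => simp
  | succ K ih =>
    have hK : (0 : ℝ) ≤ K := K.cast_nonneg
    rw [ih, Finset.sum_range_succ,
      tsum_hyperTerm_eq (x := x - K) (y := y - K) (by linarith) (by linarith) (by linarith),
      show (K : ℝ) + 1 - x = 1 - (x - K) by ring, show (K : ℝ) + 1 - y = 1 - (y - K) by ring,
      show x - ((K + 1 : ℕ) : ℝ) = x - K - 1 by push_cast; ring,
      show y - ((K + 1 : ℕ) : ℝ) = y - K - 1 by push_cast; ring, add_assoc]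

lemma tendsto_tsum_hyperTerm {x y : ℝ} (hx : x ≤ 1 / 4) (hy : y ≤ 1 / 4)
    (hxy : x - 1 ≤ y) :
    Tendsto (fun K : ℕ => ∑' m, hyperTerm (x - K) (y - K) m) atTop (𝓝 0) := by
  rw [← tsum_zero (α := ℝ) (β := ℕ)]
  refine tendsto_tsum_of_dominated_convergence summable_hyperBound (fun m => ?_)
    (Eventually.of_forall fun K m => ?_)
  · have hm : (0 : ℝ) ≤ m := m.cast_nonneg
    have h0 : Tendsto (fun K : ℕ => √((m : ℝ) + 1) / ((m + 1) * (m + 1 - (x - K))))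
        atTop (𝓝 0) := by
      refine tendsto_const_nhds.div_atTop (Tendsto.const_mul_atTop (by linarith) ?_)
      have : Tendsto (fun K : ℕ => (K : ℝ) + (m + 1 - x)) atTop atTop :=
        tendsto_atTop_add_const_right _ _ tendsto_natCast_atTop_atTop
      refine this.congr fun K => by ring
    refine squeeze_zero (fun K => ?_) (fun K => ?_) h0 <;>
      have hK : (0 : ℝ) ≤ K := K.cast_nonneg
    · exact hyperTerm_nonneg (by linarith) (by linarith) m
    · exact hyperTerm_le (by linarith) (by linarith) (by linarith) m
  · have hK : (0 : ℝ) ≤ K := K.cast_nonneg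
    rw [Real.norm_of_nonneg (hyperTerm_nonneg (by linarith) (by linarith) m)]
    exact hyperTerm_le_rpow (by linarith) (by linarith) (by linarith) m

lemma hasSum_one_div_mul {x y : ℝ} (hx : x ≤ 1 / 4) (hy : y ≤ 1 / 4) (hxy : x - 1 ≤ y) :
    HasSum (fun k : ℕ => 1 / (((k : ℝ) + 1 - x) * (k + 1 - y))) (∑' m, hyperTerm x y m) := by
  rw [hasSum_iff_tendsto_nat_of_nonneg]
  · have h := (tendsto_tsum_hyperTerm hx hy hxy).const_sub (∑' m, hyperTerm x y m)
    rw [sub_zero] at h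
    exact h.congr fun K => sub_eq_of_eq_add (tsum_hyperTerm_eq_sum_add hx hy hxy K)
  · intro k
    have hk : (0 : ℝ) ≤ k := k.cast_nonneg
    exact div_nonneg zero_le_one (mul_nonneg (by linarith) (by linarith))

lemma tsum_zero_add (a : ℕ → ℝ≥0∞) (x : ℝ≥0∞) :
    ∑' n, a n * x ^ n = a 0 + x * ∑' n, a (n + 1) * x ^ n := by
  rw [tsum_eq_zero_add' ENNReal.summable, ← ENNReal.tsum_mul_left]
  simp only [pow_zero, mul_one, pow_succ]
  congr 2 with n
  ring

lemma coeff_zero_le {a b : ℕ → ℝ≥0∞} {r : ℝ≥0∞} (hr0 : r ≠ 0)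
    (h : ∀ x, x ≠ 0 → x ≤ r → ∑' n, a n * x ^ n = ∑' n, b n * x ^ n)
    (hb : ∑' n, b n * r ^ n ≠ ∞) : a 0 ≤ b 0 := by
  refine ENNReal.le_of_forall_pos_le_add fun ε hε _ => ?_
  set C := ∑' n, b (n + 1) * r ^ n with hC
  have hCtop : C ≠ ∞ := by
    intro hc
    rw [tsum_zero_add, ← hC, hc, ENNReal.mul_top hr0] at hb
    simp at hb
  set x := min r (ε / (C + 1)) with hx
  have hx0 : x ≠ 0 := by
    have : (ε : ℝ≥0∞) / (C + 1) ≠ 0 := by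
      simp [ENNReal.div_eq_zero_iff, hε.ne', hCtop]
    exact (lt_min hr0.bot_lt this.bot_lt).ne'
  have hxr : x ≤ r := min_le_left _ _
  calc a 0 ≤ ∑' n, a n * x ^ n := by rw [tsum_zero_add]; exact le_self_add
    _ = b 0 + x * ∑' n, b (n + 1) * x ^ n := by rw [h x hx0 hxr, tsum_zero_add]
    _ ≤ b 0 + ε / (C + 1) * (C + 1) := by
      gcongr
      · exact min_le_right _ _
      · refine le_trans ?_ (le_self_add : C ≤ C + 1)
        exact ENNReal.tsum_le_tsum fun n => by gcongr
    _ ≤ b 0 + ε := by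
      gcongr
      rw [div_eq_mul_inv, mul_assoc]
      exact mul_le_of_le_one_right' (ENNReal.inv_mul_le_one _)

lemma coeff_eq_of_tsum_eq {r : ℝ≥0∞} (hr0 : r ≠ 0) (hr : r ≠ ∞) (n : ℕ) {a b : ℕ → ℝ≥0∞}
    (h : ∀ x, x ≠ 0 → x ≤ r → ∑' n, a n * x ^ n = ∑' n, b n * x ^ n)
    (hb : ∀ x, x ≠ 0 → x ≤ r → ∑' n, b n * x ^ n ≠ ∞) : a n = b n := by
  have h0 : a 0 = b 0 := le_antisymm (coeff_zero_le hr0 h (hb r hr0 le_rfl))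
    (coeff_zero_le hr0 (fun x hx hxr => (h x hx hxr).symm)
      (by rw [h r hr0 le_rfl]; exact hb r hr0 le_rfl))
  induction n generalizing a b with
  | zero => exact h0
  | succ n ih =>
    have h1 : ∀ x, x ≠ 0 → x ≤ r → ∑' n, a (n + 1) * x ^ n = ∑' n, b (n + 1) * x ^ n := by
      intro x hx hxr
      have h2 := h x hx hxr
      have h3 := hb x hx hxr
      rw [tsum_zero_add, ENNReal.add_ne_top] at h3
      rw [tsum_zero_add, tsum_zero_add b, h0, ENNReal.add_right_inj h3.1,
        ENNReal.mul_right_inj hx (ne_top_of_le_ne_top hr hxr)] at h2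
      exact h2
    have h2 : ∀ x, x ≠ 0 → x ≤ r → ∑' n, b (n + 1) * x ^ n ≠ ∞ := by
      intro x hx hxr hc
      have h3 := hb x hx hxr
      rw [tsum_zero_add, hc, ENNReal.mul_top hx] at h3
      simp at h3
    exact ih h1 h2 (le_antisymm (coeff_zero_le hr0 h1 (h2 r hr0 le_rfl))
      (coeff_zero_le hr0 (fun x hx hxr => (h1 x hx hxr).symm)
        (by rw [h1 r hr0 le_rfl]; exact h2 r hr0 le_rfl)))

lemma coeff_eq_of_tsum_tsum_eq {r : ℝ≥0∞} (hr0 : r ≠ 0) (hr : r ≠ ∞) {a b : ℕ → ℕ → ℝ≥0∞}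
    (h : ∀ x y, x ≠ 0 → x ≤ r → y ≠ 0 → y ≤ r →
      ∑' i, ∑' j, a i j * x ^ i * y ^ j = ∑' i, ∑' j, b i j * x ^ i * y ^ j)
    (hb : ∀ x y, x ≠ 0 → x ≤ r → y ≠ 0 → y ≤ r →
      ∑' i, ∑' j, b i j * x ^ i * y ^ j ≠ ∞) (i j : ℕ) : a i j = b i j ∧ b i j ≠ ∞ := by
  have e : ∀ (c : ℕ → ℕ → ℝ≥0∞) (x y : ℝ≥0∞), ∑' i, ∑' j, c i j * x ^ i * y ^ j =
      ∑' i, (∑' j, c i j * y ^ j) * x ^ i := fun c x y => by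
    refine tsum_congr fun i => ?_
    rw [← ENNReal.tsum_mul_right]
    exact tsum_congr fun j => mul_right_comm _ _ _
  simp only [e] at h hb
  have h2 : ∀ y, y ≠ 0 → y ≤ r → ∑' j, b i j * y ^ j ≠ ∞ := fun y hy hyr hc => by
    refine hb r y hr0 le_rfl hy hyr (ENNReal.tsum_eq_top_of_eq_top ⟨i, ?_⟩)
    simp [hc, hr0]
  refine ⟨coeff_eq_of_tsum_eq hr0 hr j (fun y hy hyr => ?_) h2, fun hc => ?_⟩
  · exact coeff_eq_of_tsum_eq hr0 hr i (a := fun i => ∑' j, a i j * y ^ j)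
      (b := fun i => ∑' j, b i j * y ^ j) (fun x hx hxr => h x y hx hxr hy hyr)
      (fun x hx hxr => hb x y hx hxr hy hyr)
  · refine h2 r hr0 le_rfl (ENNReal.tsum_eq_top_of_eq_top ⟨j, ?_⟩)
    simp [hc, hr0]

lemma ENNReal.prod_tsum_eq_tsum_prod {n : ℕ} (f : Fin n → ℕ → ℝ≥0∞) :
    ∏ i, ∑' k, f i k = ∑' e : Fin n → ℕ, ∏ i, f i (e i) := by
  induction n with
  | zero => simp
  | succ n ih =>
    rw [← (Fin.consEquiv fun _ : Fin (n + 1) => ℕ).tsum_eq, ENNReal.tsum_prod',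
      Fin.prod_univ_succ, ih, ← ENNReal.tsum_mul_right]
    refine tsum_congr fun k => ?_
    rw [← ENNReal.tsum_mul_left]
    refine tsum_congr fun e => ?_
    simp [Fin.prod_univ_succ]

lemma tsum_sum_antidiagonalTuple {n : ℕ} (f : (Fin n → ℕ) → ℝ≥0∞) :
    ∑' a, ∑ e ∈ Finset.Nat.antidiagonalTuple n a, f e = ∑' e, f e := by
  rw [← (Finset.Nat.sigmaAntidiagonalTupleEquivTuple n).tsum_eq, ENNReal.tsum_sigma']
  refine tsum_congr fun a => ?_
  rw [← Finset.tsum_subtype]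
  rfl

lemma sum_admissible_eq (b a : ℕ) (f : (Fin (b + 1) → ℕ) → ℝ≥0∞) :
    ∑ c ∈ (Finset.Nat.antidiagonalTuple (b + 1) (a + b + 2)).filter
        (fun c => 2 ≤ c 0 ∧ ∀ i, 1 ≤ c i), f c =
      ∑ e ∈ Finset.Nat.antidiagonalTuple (b + 1) a,
        f (Fin.cons (e 0 + 2) fun i => e i.succ + 1) := by
  symm
  refine Finset.sum_nbij' (fun e => Fin.cons (e 0 + 2) fun i => e i.succ + 1)
    (fun c => Fin.cons (c 0 - 2) fun i => c i.succ - 1) ?_ ?_ ?_ ?_ ?_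
  · intro e he
    simp only [Finset.Nat.mem_antidiagonalTuple, Finset.mem_filter, Fin.sum_univ_succ,
      Fin.forall_fin_succ, Fin.cons_zero, Fin.cons_succ, Finset.sum_add_distrib] at he ⊢
    simp
    omega
  · intro c hc
    simp only [Finset.Nat.mem_antidiagonalTuple, Finset.mem_filter, Fin.sum_univ_succ,
      Fin.forall_fin_succ, Fin.cons_zero, Fin.cons_succ] at hc ⊢
    have : ∑ i : Fin b, (c i.succ - 1) + b = ∑ i : Fin b, c i.succ := by
      conv_rhs => rw [← Finset.sum_congr rfl fun i _ => Nat.sub_add_cancel (hc.2.2.2 i)]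
      simp [Finset.sum_add_distrib]
    omega
  · intro e _
    refine funext fun i => Fin.cases ?_ (fun i => ?_) i <;> simp
  · intro c hc
    simp only [Finset.mem_filter] at hc
    refine funext fun i => Fin.cases ?_ (fun i => ?_) i
    · simp [hc.2.1]
    · simp [hc.2.2 i.succ]
  · intros; rfl

/-- The multiple zeta value as an extended nonnegative real. -/
noncomputable def mzvENN {n : ℕ} (c : Fin n → ℕ) : ℝ≥0∞ :=
  open Classical in ∑' m : Fin n → ℕ,
    if StrictAnti m ∧ ∀ i, 0 < m i then ∏ i, ((m i : ℝ≥0∞) ^ c i)⁻¹ else 0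

lemma mzv_eq_toReal {n : ℕ} (c : Fin n → ℕ) : mzv c = (mzvENN c).toReal := by
  classical
  have h := tsum_subtype {m : Fin n → ℕ | StrictAnti m ∧ ∀ i, 0 < m i}
    fun m => ∏ i, ((m i : ℝ≥0∞) ^ c i)⁻¹
  have h' : mzvENN c = ∑' m : {m : Fin n → ℕ // StrictAnti m ∧ ∀ i, 0 < m i},
      ∏ i, ((m.1 i : ℝ≥0∞) ^ c i)⁻¹ := by
    refine Eq.trans ?_ h.symm
    refine tsum_congr fun m => ?_
    simp only [Set.indicator_apply, Set.mem_ofPred_eq]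
  rw [h', ENNReal.tsum_toReal_eq, mzv]
  · refine tsum_congr fun m => ?_
    simp
  · intro m
    refine ENNReal.prod_ne_top fun i _ => ?_
    have := (m.2.2 i).ne'
    simp [this]

/-- The sum of `∏ g (m i)` over strictly decreasing `b`-tuples of positive integers below `M`. -/
noncomputable def truncSum (g : ℕ → ℝ≥0∞) (b M : ℕ) : ℝ≥0∞ :=
  open Classical in ∑' m : Fin b → ℕ,
    if (StrictAnti m ∧ ∀ i, 0 < m i) ∧ ∀ i, m i < M then ∏ i, g (m i) else 0

lemma Fin.strictAnti_cons_iff {b : ℕ} (k : ℕ) (m : Fin b → ℕ) :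
    StrictAnti (Fin.cons k m : Fin (b + 1) → ℕ) ↔ (∀ i, m i < k) ∧ StrictAnti m :=
  Fin.liftFun_cons (· > ·)

lemma tsum_strictAnti_succ (g w : ℕ → ℝ≥0∞) (b : ℕ) :
    (open Classical in ∑' m : Fin (b + 1) → ℕ, if StrictAnti m ∧ ∀ i, 0 < m i then
      w (m 0) * ∏ i : Fin b, g (m i.succ) else 0) =
    ∑' k, w (k + 1) * truncSum g b (k + 1) := by
  classical
  have e : ∀ k (m : Fin b → ℕ), Fin.consEquiv (fun _ : Fin (b + 1) => ℕ) (k, m) =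
      (Fin.cons k m : Fin (b + 1) → ℕ) := fun _ _ => rfl
  rw [← (Fin.consEquiv fun _ : Fin (b + 1) => ℕ).tsum_eq, ENNReal.tsum_prod',
    tsum_eq_zero_add' ENNReal.summable]
  simp only [e, Fin.strictAnti_cons_iff, Fin.forall_fin_succ, Fin.cons_zero,
    Fin.cons_succ, truncSum]
  simp only [lt_irrefl, false_and, and_false, if_false, tsum_zero, zero_add]
  refine tsum_congr fun k => ?_
  rw [← ENNReal.tsum_mul_left]
  refine tsum_congr fun m => ?_
  rw [mul_ite, mul_zero]
  refine if_congr ?_ rfl rfl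
  simp
  tauto

lemma truncSum_zero (g : ℕ → ℝ≥0∞) (M : ℕ) : truncSum g 0 M = 1 := by
  simp [truncSum, StrictAnti]

lemma truncSum_succ (g : ℕ → ℝ≥0∞) (b m : ℕ) :
    truncSum g (b + 1) (m + 1) = ∑ k ∈ Finset.range m, g (k + 1) * truncSum g b (k + 1) := by
  classical
  have h := tsum_strictAnti_succ g (fun k => if k < m + 1 then g k else 0) b
  rw [tsum_eq_sum (s := Finset.range m)] at h
  · rw [← Finset.sum_congr rfl fun k hk => ?_, ← h, truncSum]
    · refine tsum_congr fun t => ?_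
      by_cases ht : StrictAnti t ∧ ∀ i, 0 < t i
      · have : (∀ i, t i < m + 1) ↔ t 0 < m + 1 :=
          ⟨fun h => h 0, fun h i => (ht.1.antitone (Fin.zero_le i)).trans_lt h⟩
        simp only [this, ht, true_and, Fin.prod_univ_succ, if_true, implies_true]
        split_ifs <;> simp
      · simp only [ht, false_and, if_false]
    · rw [if_pos (by simpa using hk)]
  · intro k hk
    rw [if_neg (by simpa using hk), zero_mul]

lemma tsum_truncSum_mul_pow (g : ℕ → ℝ≥0∞) (y : ℝ≥0∞) (m : ℕ) :
    ∑' b, truncSum g b (m + 1) * y ^ b = ∏ j ∈ Finset.range m, (1 + y * g (j + 1)) := by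
  induction m with
  | zero => rw [tsum_zero_add]; simp [truncSum_zero, truncSum_succ]
  | succ m ih =>
    rw [Finset.prod_range_succ, ← ih, tsum_zero_add, truncSum_zero]
    simp only [truncSum_succ _ _ (m + 1), Finset.sum_range_succ, add_mul]
    rw [ENNReal.tsum_add, mul_add, ← add_assoc]
    simp only [← truncSum_succ]
    rw [mul_add, mul_one]
    congr 1
    · rw [tsum_zero_add (fun b => truncSum g b (m + 1)), truncSum_zero]
    · simp only [mul_assoc, ENNReal.tsum_mul_left]
      ring

/-- The geometric series `∑ xᵃ / Mᵃ⁺¹`, equal to `1 / (M - x)`. -/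
noncomputable def geomENN (x : ℝ≥0∞) (M : ℕ) : ℝ≥0∞ :=
  ∑' a, ((M : ℝ≥0∞) ^ (a + 1))⁻¹ * x ^ a

lemma geomENN_ofReal {x : ℝ} (hx : 0 ≤ x) (hx1 : x < 1) (m : ℕ) :
    geomENN (ENNReal.ofReal x) (m + 1) = ENNReal.ofReal (1 / (m + 1 - x)) := by
  have hm : (0 : ℝ) ≤ m := m.cast_nonneg
  have h1 : x / (m + 1) < 1 := by rw [div_lt_one (by linarith)]; linarith
  have h0 : 0 ≤ x / (m + 1) := by positivity
  have h : HasSum (fun a : ℕ => (((m : ℝ) + 1) ^ (a + 1))⁻¹ * x ^ a) (1 / (m + 1 - x)) := by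
    have h2 : (m : ℝ) + 1 - x ≠ 0 := by linarith
    have h3 : 1 / ((m : ℝ) + 1) * (1 - x / (m + 1))⁻¹ = 1 / (m + 1 - x) := by
      rw [one_sub_div (by positivity)]
      field_simp
    rw [← h3]
    refine ((hasSum_geometric_of_lt_one h0 h1).mul_left (1 / ((m : ℝ) + 1))).congr_fun ?_
    intro a
    rw [div_pow, pow_succ]
    field_simp
  rw [← h.tsum_eq, ENNReal.ofReal_tsum_of_nonneg (fun a => by positivity) h.summable]
  refine tsum_congr fun a => ?_
  rw [ENNReal.ofReal_mul (by positivity), ENNReal.ofReal_inv_of_pos (by positivity),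
    ENNReal.ofReal_pow (by positivity), ENNReal.ofReal_pow hx]
  congr 3
  norm_cast

/-- The sum of all multiple zeta values of depth `b + 1` and weight `a + b + 2`. -/
noncomputable def mzvSum (a b : ℕ) : ℝ≥0∞ :=
  ∑ c ∈ (Finset.Nat.antidiagonalTuple (b + 1) (a + b + 2)).filter
    (fun c => 2 ≤ c 0 ∧ ∀ i, 1 ≤ c i), mzvENN c

lemma tsum_mzvSum_mul_pow (b : ℕ) (x : ℝ≥0∞) :
    ∑' a, mzvSum a b * x ^ a =
      ∑' k : ℕ, (((k + 1 : ℕ) : ℝ≥0∞)⁻¹ * geomENN x (k + 1)) * truncSum (geomENN x) b (k + 1) := by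
  classical
  rw [← tsum_strictAnti_succ (geomENN x) (fun k => (k : ℝ≥0∞)⁻¹ * geomENN x k)]
  have h1 : ∀ a, mzvSum a b * x ^ a = ∑ e ∈ Finset.Nat.antidiagonalTuple (b + 1) a,
      mzvENN (Fin.cons (e 0 + 2) fun i => e i.succ + 1 : Fin (b + 1) → ℕ) * x ^ ∑ i, e i := by
    intro a
    rw [mzvSum, sum_admissible_eq, Finset.sum_mul]
    refine Finset.sum_congr rfl fun e he => ?_
    rw [Finset.Nat.mem_antidiagonalTuple.1 he]
  simp only [h1]
  rw [tsum_sum_antidiagonalTuple fun e : Fin (b + 1) → ℕ =>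
    mzvENN (Fin.cons (e 0 + 2) fun i => e i.succ + 1 : Fin (b + 1) → ℕ) * x ^ ∑ i, e i]
  simp only [mzvENN, ← ENNReal.tsum_mul_right]
  rw [ENNReal.tsum_comm]
  refine tsum_congr fun m => ?_
  split_ifs with hm
  · rw [mul_assoc, ← Fin.prod_univ_succ fun i => geomENN x (m i)]
    simp only [geomENN]
    rw [ENNReal.prod_tsum_eq_tsum_prod, ← ENNReal.tsum_mul_left]
    refine tsum_congr fun e => ?_
    rw [Finset.prod_mul_distrib, ← Finset.prod_pow_eq_pow_sum, ← mul_assoc]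
    congr 1
    rw [Fin.prod_univ_succ, Fin.prod_univ_succ, ← mul_assoc]
    simp only [Fin.cons_zero, Fin.cons_succ]
    congr 1
    rw [pow_succ _ (e 0 + 1), ENNReal.mul_inv (by simp) (by simp), mul_comm]
  · simp

lemma tsum_tsum_mzvSum (x y : ℝ≥0∞) :
    ∑' a, ∑' b, mzvSum a b * x ^ a * y ^ b =
      ∑' k : ℕ, (((k + 1 : ℕ) : ℝ≥0∞)⁻¹ * geomENN x (k + 1)) *
        ∏ j ∈ Finset.range k, (1 + y * geomENN x (j + 1)) := by
  rw [ENNReal.tsum_comm]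
  simp only [ENNReal.tsum_mul_right, tsum_mzvSum_mul_pow]
  simp only [← ENNReal.tsum_mul_right]
  rw [ENNReal.tsum_comm]
  refine tsum_congr fun k => ?_
  simp only [mul_assoc, ENNReal.tsum_mul_left, tsum_truncSum_mul_pow]

/-- The zeta value as an extended nonnegative real. -/
noncomputable def zetaENN (k : ℕ) : ℝ≥0∞ := ∑' m : ℕ, (((m + 1 : ℕ) : ℝ≥0∞) ^ k)⁻¹

lemma rz_eq_toReal (k : ℕ) : rz k = (zetaENN k).toReal := by
  rw [rz, tsum_pnat_eq_tsum_succ (f := fun m : ℕ => ((m : ℝ) ^ k)⁻¹), zetaENN,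
    ENNReal.tsum_toReal_eq]
  · refine tsum_congr fun m => ?_
    rw [ENNReal.toReal_inv, ENNReal.toReal_pow, ENNReal.toReal_natCast]
  · intro m
    simp

lemma tsum_tsum_zetaENN (x y : ℝ≥0∞) :
    ∑' a, ∑' b, zetaENN (a + b + 2) * x ^ a * y ^ b =
      ∑' m : ℕ, geomENN x (m + 1) * geomENN y (m + 1) := by
  simp only [zetaENN, geomENN, ← ENNReal.tsum_mul_right]
  have h : ∀ a : ℕ, ∑' b : ℕ, ∑' m : ℕ, (((m + 1 : ℕ) : ℝ≥0∞) ^ (a + b + 2))⁻¹ * x ^ a * y ^ b =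
      ∑' m : ℕ, ∑' b : ℕ, (((m + 1 : ℕ) : ℝ≥0∞) ^ (a + b + 2))⁻¹ * x ^ a * y ^ b :=
    fun a => ENNReal.tsum_comm
  simp only [h]
  rw [ENNReal.tsum_comm]
  refine tsum_congr fun m => tsum_congr fun a => ?_
  rw [← ENNReal.tsum_mul_left]
  refine tsum_congr fun b => ?_
  rw [show a + b + 2 = (a + 1) + (b + 1) by ring, pow_add,
    ENNReal.mul_inv (by simp) (by simp)]
  ring

lemma tsum_geomENN_mul {x y : ℝ} (hx : 0 ≤ x) (hx4 : x ≤ 1 / 4) (hy : 0 ≤ y)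
    (hy4 : y ≤ 1 / 4) :
    ∑' m : ℕ, geomENN (ENNReal.ofReal x) (m + 1) * geomENN (ENNReal.ofReal y) (m + 1) =
      ENNReal.ofReal (∑' m, hyperTerm x y m) := by
  have h := hasSum_one_div_mul hx4 hy4 (by linarith)
  have hx' : ∀ m : ℕ, 0 < (m : ℝ) + 1 - x := fun m => by
    have := m.cast_nonneg (α := ℝ); linarith
  have hy' : ∀ m : ℕ, 0 < (m : ℝ) + 1 - y := fun m => by
    have := m.cast_nonneg (α := ℝ); linarith
  rw [← h.tsum_eq, ENNReal.ofReal_tsum_of_nonneg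
    (fun m => (one_div_pos.2 (mul_pos (hx' m) (hy' m))).le) h.summable]
  refine tsum_congr fun m => ?_
  rw [geomENN_ofReal hx (by linarith), geomENN_ofReal hy (by linarith),
    ← ENNReal.ofReal_mul (one_div_pos.2 (hx' m)).le, one_div_mul_one_div]

lemma tsum_geomENN_mul_prod {x y : ℝ} (hx : 0 ≤ x) (hx4 : x ≤ 1 / 4) (hy : 0 ≤ y)
    (hy4 : y ≤ 1 / 4) :
    ∑' k : ℕ, (((k + 1 : ℕ) : ℝ≥0∞)⁻¹ * geomENN (ENNReal.ofReal x) (k + 1)) *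
        ∏ j ∈ Finset.range k, (1 + ENNReal.ofReal y * geomENN (ENNReal.ofReal x) (j + 1)) =
      ENNReal.ofReal (∑' m, hyperTerm x y m) := by
  have hx' : ∀ m : ℕ, 0 < (m : ℝ) + 1 - x := fun m => by
    have := m.cast_nonneg (α := ℝ); linarith
  rw [ENNReal.ofReal_tsum_of_nonneg (hyperTerm_nonneg hx4 (by linarith))
    (summable_hyperTerm hx4 hy4 (by linarith))]
  refine tsum_congr fun k => ?_
  have h1 : ∀ j : ℕ, 1 + ENNReal.ofReal y * geomENN (ENNReal.ofReal x) (j + 1) =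
      ENNReal.ofReal (1 + y / (j + 1 - x)) := fun j => by
    rw [geomENN_ofReal hx (by linarith), ← ENNReal.ofReal_mul hy, mul_one_div,
      ENNReal.ofReal_add zero_le_one (div_nonneg hy (hx' j).le), ENNReal.ofReal_one]
  simp only [h1]
  rw [← ENNReal.ofReal_prod_of_nonneg fun j _ =>
      add_nonneg zero_le_one (div_nonneg hy (hx' j).le),
    geomENN_ofReal hx (by linarith), ← ENNReal.ofReal_natCast,
    ← ENNReal.ofReal_inv_of_pos (by positivity), ← ENNReal.ofReal_mul (by positivity),
    ← ENNReal.ofReal_mul (mul_nonneg (by positivity) (one_div_pos.2 (hx' k)).le)]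
  congr 1
  rw [hyperTerm, shiftedProd]
  push_cast
  rw [div_eq_mul_inv _ (((k : ℝ) + 1) * (k + 1 - x)), mul_inv, one_div, mul_comm]

lemma mzvSum_eq_zetaENN (a b : ℕ) :
    mzvSum a b = zetaENN (a + b + 2) ∧ zetaENN (a + b + 2) ≠ ∞ := by
  have real_of : ∀ x : ℝ≥0∞, x ≤ ENNReal.ofReal (1 / 4) →
      ∃ r : ℝ, 0 ≤ r ∧ r ≤ 1 / 4 ∧ x = ENNReal.ofReal r := fun x hx =>
    ⟨x.toReal, ENNReal.toReal_nonneg, ENNReal.toReal_le_of_le_ofReal (by norm_num) hx,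
      (ENNReal.ofReal_toReal (ne_top_of_le_ne_top ENNReal.ofReal_ne_top hx)).symm⟩
  refine coeff_eq_of_tsum_tsum_eq (r := ENNReal.ofReal (1 / 4)) (a := mzvSum)
    (b := fun a b => zetaENN (a + b + 2)) (by simp) ENNReal.ofReal_ne_top ?_ ?_ a b
  · intro x y _ hx _ hy
    obtain ⟨x, hx0, hx4, rfl⟩ := real_of x hx
    obtain ⟨y, hy0, hy4, rfl⟩ := real_of y hy
    rw [tsum_tsum_mzvSum, tsum_tsum_zetaENN, tsum_geomENN_mul hx0 hx4 hy0 hy4,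
      tsum_geomENN_mul_prod hx0 hx4 hy0 hy4]
  · intro x y _ hx _ hy
    obtain ⟨x, hx0, hx4, rfl⟩ := real_of x hx
    obtain ⟨y, hy0, hy4, rfl⟩ := real_of y hy
    rw [tsum_tsum_zetaENN, tsum_geomENN_mul hx0 hx4 hy0 hy4]
    exact ENNReal.ofReal_ne_top

/-- Sum formula: the sum of all multiple zeta values of weight `l` and depth `n`
equals `ζ(l)`. -/
theorem sum_formula (l n : ℕ) (hn : 1 ≤ n) (hln : n < l) :
    ∑ c ∈ (Finset.Nat.antidiagonalTuple n l).filter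
        (fun c => 2 ≤ c ⟨0, hn⟩ ∧ ∀ i, 1 ≤ c i), mzv c = rz l := by
  obtain ⟨b, rfl⟩ : ∃ b, n = b + 1 := ⟨n - 1, by omega⟩
  obtain ⟨a, rfl⟩ : ∃ a, l = a + b + 2 := ⟨l - b - 2, by omega⟩
  obtain ⟨h, htop⟩ := mzvSum_eq_zetaENN a b
  rw [rz_eq_toReal, ← h, mzvSum, ENNReal.toReal_sum]
  · exact Finset.sum_congr rfl fun c _ => mzv_eq_toReal c
  · rw [← h, mzvSum] at htop
    exact fun c hc => ENNReal.sum_ne_top.1 htop c hc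
end

section
/- Let n be a positive integer and m₁, …, m_n complex numbers such that all the partial sums m_i + m_{i+1} + ⋯ + m_j (1 ≤ i ≤ j ≤ n) are nonzero. Define P_n(m₁,…,m_n) = Π_{i=1}^{n} 1/(m_i + m_{i+1} + ⋯ + m_n). Then P_n(m₁,…,m_n) = Σ_{j=1}^{n} (−1)^{n−j} P_{j−1}(m₁,…,m_{j−1}) · P_{n+1−j}(m_n, m_{n−1},…,m_j), where P_0 of the empty tuple is interpreted as 1. -/
open scoped BigOperators

/-- `P (m₁, …, mₙ) = Π_{i=1}^{n} 1/(mᵢ + m_{i+1} + ⋯ + mₙ)`; the empty product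
(`n = 0`) is `1`. -/
noncomputable def P {n : ℕ} (m : Fin n → ℂ) : ℂ :=
  ∏ i, (∑ j ∈ Finset.Ici i, m j)⁻¹

open Finset

theorem P_eq_prod_range (g : ℕ → ℂ) (n : ℕ) :
    P (fun i : Fin n => g i) = ∏ i ∈ range n, (∑ k ∈ Ico i n, g k)⁻¹ := by
  rw [P, prod_range]
  refine prod_congr rfl fun i _ => ?_
  rw [← Fin.map_valEmbedding_Ici, sum_map]
  rfl

theorem P_reverse_eq_prod_Ico (g : ℕ → ℂ) {j n : ℕ} (hj : j < n) :
    P (fun i : Fin (n - j) => g (n - 1 - i)) =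
      ∏ k ∈ Ico (j + 1) (n + 1), (∑ l ∈ Ico j k, g l)⁻¹ := by
  have hreflect := prod_Ico_reflect (fun k => (∑ l ∈ Ico j k, g l)⁻¹) 0
    (show n - j ≤ n + 1 by omega)
  rw [show n + 1 - (n - j) = j + 1 by omega, Nat.sub_zero] at hreflect
  rw [P_eq_prod_range (fun i => g (n - 1 - i)), ← hreflect, Nat.Ico_zero_eq_range]
  refine prod_congr rfl fun i _ => ?_
  rw [sum_Ico_reflect g i (show n - j ≤ n - 1 + 1 by omega),
    show n - 1 + 1 - (n - j) = j by omega, show n - 1 + 1 - i = n - i by omega]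

theorem sum_inv_prod_sub_eq_zero {F : Type*} [Field F] {n : ℕ} (hn : 1 ≤ n) {v : ℕ → F}
    (hv : Set.InjOn v (range (n + 1))) :
    ∑ i ∈ range (n + 1), (∏ j ∈ (range (n + 1)).erase i, (v i - v j))⁻¹ = 0 := by
  have hcoeff := Lagrange.coeff_eq_sum hv (P := 1) (by simp; norm_cast; omega)
  simpa [Polynomial.coeff_one, show n ≠ 0 by omega] using hcoeff.symm

theorem inv_prod_erase_sub {F : Type*} [Field F] {j n : ℕ} (hj : j ≤ n) (v : ℕ → F) :
    (∏ i ∈ (range (n + 1)).erase j, (v j - v i))⁻¹ =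
      (-1) ^ (n - j) * (∏ i ∈ range j, (v j - v i)⁻¹) *
        ∏ k ∈ Ico (j + 1) (n + 1), (v k - v j)⁻¹ := by
  have hsplit : (range (n + 1)).erase j = range j ∪ Ico (j + 1) (n + 1) := by
    ext; simp; omega
  have hdisj : Disjoint (range j) (Ico (j + 1) (n + 1)) := by
    rw [disjoint_left]; simp; omega
  have hneg : ∏ k ∈ Ico (j + 1) (n + 1), (v j - v k)⁻¹ =
      (-1) ^ (n - j) * ∏ k ∈ Ico (j + 1) (n + 1), (v k - v j)⁻¹ := by
    simp_rw [← neg_sub (v _) (v j), inv_neg, prod_neg, Nat.card_Ico, Nat.add_sub_add_right]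
  rw [hsplit, ← prod_inv_distrib, prod_union hdisj, hneg]
  ring

/-- Partial-fraction identity:
`P_n(m₁,…,mₙ) = Σ_{j=1}^{n} (-1)^(n-j) P_{j-1}(m₁,…,m_{j-1}) P_{n+1-j}(mₙ,…,m_j)`,
assuming all interval sums `mᵢ + ⋯ + m_j` are nonzero.  The summation index
`j : Fin n` encodes the one-based index `j + 1 ∈ {1, …, n}`. -/
theorem partial_fraction_identity (n : ℕ) (hn : 1 ≤ n) (m : Fin n → ℂ)
    (h : ∀ i j : Fin n, i ≤ j → ∑ k ∈ Finset.Icc i j, m k ≠ 0) :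
    P m = ∑ j : Fin n, (-1 : ℂ) ^ (n - 1 - j.val)
        * P (fun i : Fin j.val => m (Fin.castLE j.isLt.le i))
        * P (fun i : Fin (n - j.val) => m ⟨n - 1 - i.val, by omega⟩) := by
  obtain ⟨g, rfl⟩ : ∃ g : ℕ → ℂ, m = fun i : Fin n => g i :=
    ⟨fun k => if hk : k < n then m ⟨k, hk⟩ else 0, by simp⟩
  let S : ℕ → ℂ := fun k => ∑ l ∈ range k, g l
  have hS : ∀ {i j : ℕ}, i ≤ j → ∑ l ∈ Ico i j, g l = S j - S i :=
    fun hij => sum_Ico_eq_sub g hij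
  have hne : ∀ i j : ℕ, i < j → j ≤ n → S i ≠ S j := by
    intro i j hij hj heq
    refine h ⟨i, by omega⟩ ⟨j - 1, by omega⟩ (Fin.mk_le_mk.2 (by omega)) ?_
    have hmap := Fin.map_valEmbedding_Icc (⟨i, by omega⟩ : Fin n) ⟨j - 1, by omega⟩
    have hIcc : Icc i (j - 1) = Ico i j := by ext; simp; omega
    calc _ = ∑ k ∈ Icc i (j - 1), g k := by rw [← hmap, sum_map]; rfl
      _ = 0 := by rw [hIcc, hS hij.le, heq, sub_self]
  have hinj : Set.InjOn S (range (n + 1)) := by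
    intro i hi j hj hij
    simp only [coe_range, Set.mem_Iio] at hi hj
    rcases lt_trichotomy i j with hlt | heq | hlt
    · exact absurd hij (hne i j hlt (by omega))
    · exact heq
    · exact absurd hij.symm (hne j i hlt (by omega))
  have hP : ∀ j, P (fun i : Fin j => g i) = ∏ i ∈ range j, (S j - S i)⁻¹ := fun j => by
    rw [P_eq_prod_range]
    exact prod_congr rfl fun i hi => by rw [hS (mem_range.1 hi).le]
  have hterm : ∀ j : Fin n, (∏ i ∈ (range (n + 1)).erase j, (S j - S i))⁻¹ =
      -((-1 : ℂ) ^ (n - 1 - j.val) * P (fun i : Fin j.val => g i)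
        * P (fun i : Fin (n - j.val) => g (n - 1 - i))) := by
    intro j
    have hrev : P (fun i : Fin (n - j.val) => g (n - 1 - i)) =
        ∏ k ∈ Ico (j.val + 1) (n + 1), (S k - S j)⁻¹ := by
      rw [P_reverse_eq_prod_Ico g j.isLt]
      exact prod_congr rfl fun k hk => by rw [hS (Nat.le_of_succ_le (mem_Ico.1 hk).1)]
    rw [inv_prod_erase_sub j.isLt.le, hP, hrev,
      show n - j.val = n - 1 - j.val + 1 by omega, pow_succ]
    ring
  have hzero := sum_inv_prod_sub_eq_zero hn hinj
  rw [sum_range_succ, inv_prod_erase_sub le_rfl, ← hP, sum_range, sum_congr rfl fun j _ => hterm j,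
    sum_neg_distrib] at hzero
  simp only [Nat.sub_self, pow_zero, one_mul, Ico_self, prod_empty, mul_one] at hzero
  exact (neg_add_eq_zero.1 hzero).symm
end
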